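/- Let L ∈ B(H,G) satisfy 0 < ‖L‖ ≤ 1, let g : G → (−∞,+∞] be proper with a continuous affine minorant, and let x ∈ H. Then: (i) the function γ ↦ (L ⊙_γ g)(x) on (0,+∞) is decreasing (antitone), and so is γ ↦ (L ⊚_γ g)(x); (ii) lim_{γ→+∞} (L ⊙_γ g)(x) = inf { g**(y) : y ∈ G, L*y = x } (a limit in [−∞,+∞]); (iii) lim_{γ→0⁺} (L ⊚_γ g)(x) = g**(Lx); (iv) if moreover ‖L‖ < 1, then lim_{γ→+∞} (L ⊚_γ g)(x) = inf_{y ∈ G} g**(y). -/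

import Mathlib

open scoped RealInnerProductSpace
open Filter Set

noncomputable section

/-- Fenchel (Legendre) conjugate of an extended-real-valued function. -/
def fconj {H : Type*} [NormedAddCommGroup H] [InnerProductSpace ℝ H]
    (f : H → EReal) : H → EReal :=
  fun xs => ⨆ x : H, (⟪x, xs⟫ : EReal) - f x

/-- Moreau envelope of index `γ`. -/
def menv {H : Type*} [NormedAddCommGroup H] (γ : ℝ) (f : H → EReal) : H → EReal :=
  fun x => ⨅ y : H, f y + ((‖x - y‖ ^ 2 / (2 * γ) : ℝ) : EReal)

/-- Quadratic kernel `Q`. -/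
def qk {H : Type*} [NormedAddCommGroup H] (x : H) : ℝ := ‖x‖ ^ 2 / 2

/-- Proximal composition `L ⊙_γ g`. -/
def proxComp {H G : Type*} [NormedAddCommGroup H] [InnerProductSpace ℝ H]
    [NormedAddCommGroup G] [InnerProductSpace ℝ G]
    (L : H →L[ℝ] G) (γ : ℝ) (g : G → EReal) : H → EReal :=
  fun x => fconj (fun z => menv (1 / γ) (fconj g) (L z)) x - (((1 / γ) * qk x : ℝ) : EReal)

/-- Proximal cocomposition `L ⊚_γ g`. -/
def proxCocomp {H G : Type*} [NormedAddCommGroup H] [InnerProductSpace ℝ H]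
    [NormedAddCommGroup G] [InnerProductSpace ℝ G]
    (L : H →L[ℝ] G) (γ : ℝ) (g : G → EReal) : H → EReal :=
  fconj (proxComp L (1 / γ) (fconj g))

/-- `f` is proper: not identically `+∞` and never `−∞`. -/
def ProperE {H : Type*} (f : H → EReal) : Prop :=
  (∃ x, f x ≠ ⊤) ∧ ∀ x, f x ≠ ⊥

/-- `f` admits a continuous affine minorant. -/
def HasAffMinorant {H : Type*} [NormedAddCommGroup H] [InnerProductSpace ℝ H]
    (f : H → EReal) : Prop :=
  ∃ (u : H) (c : ℝ), ∀ x, ((⟪x, u⟫ + c : ℝ) : EReal) ≤ f x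

/-- Convexity for extended-real-valued functions. -/
def ConvexE {H : Type*} [NormedAddCommGroup H] [InnerProductSpace ℝ H]
    (f : H → EReal) : Prop :=
  ∀ x y : H, ∀ a b : ℝ, 0 < a → 0 < b → a + b = 1 →
    f (a • x + b • y) ≤ ((a : ℝ) : EReal) * f x + ((b : ℝ) : EReal) * f y

/-- The class `Γ₀`: proper, lower semicontinuous, convex. -/
def IsGamma0 {H : Type*} [NormedAddCommGroup H] [InnerProductSpace ℝ H]
    (f : H → EReal) : Prop :=
  ProperE f ∧ LowerSemicontinuous f ∧ ConvexE f

/-- `p` is a proximal point of `f` at `x`. -/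
def IsProx {H : Type*} [NormedAddCommGroup H] (f : H → EReal) (x p : H) : Prop :=
  ∀ y : H, f p + ((‖x - p‖ ^ 2 / 2 : ℝ) : EReal) ≤ f y + ((‖x - y‖ ^ 2 / 2 : ℝ) : EReal)

/-- Subdifferential. -/
def SubdiffE {H : Type*} [NormedAddCommGroup H] [InnerProductSpace ℝ H]
    (f : H → EReal) (x : H) : Set H :=
  {xs | ∀ y : H, (⟪y - x, xs⟫ : EReal) + f x ≤ f y}

/-- Recession function. -/
def recE {H : Type*} [NormedAddCommGroup H] (f : H → EReal) : H → EReal :=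
  fun x => ⨆ y : {y : H // f y ≠ ⊤}, f (x + (y : H)) - f (y : H)

end

/-- A real upper bound of a conjugate, read as an affine minorant. -/
lemma fconj_le_coe_iff {H : Type*} [NormedAddCommGroup H] [InnerProductSpace ℝ H]
    (f : H → EReal) (y : H) (r : ℝ) :
    fconj f y ≤ (r : EReal) ↔ ∀ x, ((⟪x, y⟫ - r : ℝ) : EReal) ≤ f x := by
  unfold fconj
  rw [iSup_le_iff]
  refine forall_congr' fun x => ?_
  induction f x with
  | bot => simp [-EReal.coe_sub]
  | top => simp
  | coe t => norm_cast; constructor <;> intro h <;> linarith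

lemma EReal.le_of_forall_coe_ge {a b : EReal} (h : ∀ r : ℝ, b ≤ r → a ≤ r) : a ≤ b :=
  EReal.le_of_forall_lt_iff_le.1 fun r hr => h r hr.le

lemma EReal.coe_sub_le_iff {a b : ℝ} {t : EReal} :
    ((a - b : ℝ) : EReal) ≤ t ↔ (a : EReal) ≤ t + (b : EReal) := by
  induction t with
  | bot => simp [-EReal.coe_sub]
  | top => simp
  | coe t => norm_cast; constructor <;> intro h <;> linarith

lemma fconj_antitone {H : Type*} [NormedAddCommGroup H] [InnerProductSpace ℝ H]
    {f g : H → EReal} (hfg : ∀ x, f x ≤ g x) (y : H) : fconj g y ≤ fconj f y :=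
  EReal.le_of_forall_coe_ge fun _ hr =>
    (fconj_le_coe_iff _ _ _).2 fun x => ((fconj_le_coe_iff _ _ _).1 hr x).trans (hfg x)

lemma fconj_fconj_le {H : Type*} [NormedAddCommGroup H] [InnerProductSpace ℝ H]
    (f : H → EReal) (x : H) : fconj (fconj f) x ≤ f x := by
  refine EReal.le_of_forall_coe_ge fun r hr => (fconj_le_coe_iff _ _ _).2 fun y => ?_
  refine EReal.le_of_forall_coe_ge fun s hs => ?_
  have h := ((fconj_le_coe_iff _ _ _).1 hs x).trans hr
  rw [real_inner_comm]
  norm_cast at h ⊢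
  linarith

lemma fconj_fconj_fconj {H : Type*} [NormedAddCommGroup H] [InnerProductSpace ℝ H]
    (f : H → EReal) : fconj (fconj (fconj f)) = fconj f :=
  funext fun y => le_antisymm (fconj_fconj_le _ y) (fconj_antitone (fconj_fconj_le f) y)

lemma convex_epigraph_fconj {H : Type*} [NormedAddCommGroup H] [InnerProductSpace ℝ H]
    (f : H → EReal) : Convex ℝ {p : H × ℝ | fconj f p.1 ≤ (p.2 : EReal)} := by
  intro p hp q hq a b ha hb hab
  simp only [Set.mem_ofPred_eq, fconj_le_coe_iff] at hp hq ⊢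
  intro x
  have hp' := hp x
  have hq' := hq x
  have hmax : (⟪x, (a • p + b • q).1⟫ - (a • p + b • q).2 : ℝ) ≤
      max (⟪x, p.1⟫ - p.2 : ℝ) (⟪x, q.1⟫ - q.2) := by
    have h1 := mul_le_mul_of_nonneg_left (le_max_left (⟪x, p.1⟫ - p.2 : ℝ) (⟪x, q.1⟫ - q.2)) ha
    have h2 := mul_le_mul_of_nonneg_left (le_max_right (⟪x, p.1⟫ - p.2 : ℝ) (⟪x, q.1⟫ - q.2)) hb
    have h3 : a * max (⟪x, p.1⟫ - p.2 : ℝ) (⟪x, q.1⟫ - q.2) +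
        b * max (⟪x, p.1⟫ - p.2 : ℝ) (⟪x, q.1⟫ - q.2) =
        max (⟪x, p.1⟫ - p.2 : ℝ) (⟪x, q.1⟫ - q.2) := by rw [← add_mul, hab, one_mul]
    simp only [Prod.fst_add, Prod.smul_fst, Prod.snd_add, Prod.smul_snd, inner_add_right,
      real_inner_smul_right, smul_eq_mul]
    linarith
  refine (EReal.coe_le_coe_iff.2 hmax).trans ?_
  rcases max_choice (⟪x, p.1⟫ - p.2 : ℝ) (⟪x, q.1⟫ - q.2) with h | h <;> rw [h] <;> assumption

lemma isOpen_strict_epigraph_sq {G : Type*} [NormedAddCommGroup G] (μ : ℝ) :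
    IsOpen {p : G × ℝ | ‖p.1‖ ^ 2 / (2 * μ) < p.2} :=
  isOpen_lt (by fun_prop) (by fun_prop)

lemma convex_strict_epigraph_sq {G : Type*} [NormedAddCommGroup G] [InnerProductSpace ℝ G]
    {μ : ℝ} (hμ : 0 < μ) : Convex ℝ {p : G × ℝ | ‖p.1‖ ^ 2 / (2 * μ) < p.2} := by
  have h : ConvexOn ℝ Set.univ fun u : G => ‖u‖ ^ 2 / (2 * μ) := by
    have h2 : ConvexOn ℝ Set.univ fun u : G => ‖u‖ ^ 2 :=
      (convexOn_norm convex_univ).pow (fun _ _ => norm_nonneg _) 2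
    have h3 := h2.smul (c := (2 * μ)⁻¹) (by positivity)
    refine h3.congr fun u _ => ?_
    simp only [smul_eq_mul]
    ring
  simpa using h.convex_strict_epigraph

open scoped Pointwise in
/-- Strong duality for the conjugate of a Moreau envelope composed with `L`. -/
lemma forall_le_iff_exists_adjoint_eq {H G : Type*}
    [NormedAddCommGroup H] [InnerProductSpace ℝ H] [CompleteSpace H]
    [NormedAddCommGroup G] [InnerProductSpace ℝ G] [CompleteSpace G]
    (L : H →L[ℝ] G) {μ : ℝ} (hμ : 0 < μ) (h : G → EReal)
    (hconv : Convex ℝ {p : G × ℝ | h p.1 ≤ (p.2 : EReal)})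
    (hne : {p : G × ℝ | h p.1 ≤ (p.2 : EReal)}.Nonempty) (x : H) (r : ℝ) :
    (∀ z w, ((⟪z, x⟫ - r - ‖L z - w‖ ^ 2 / (2 * μ) : ℝ) : EReal) ≤ h w) ↔
      ∃ y, ContinuousLinearMap.adjoint L y = x ∧
        ∀ w, ((⟪w, y⟫ - (r - μ * qk y) : ℝ) : EReal) ≤ h w := by
  constructor
  · intro hle
    obtain ⟨f, c, hfA, hfB⟩ := geometric_hahn_banach_open
      (s := {p : G × ℝ | h p.1 ≤ (p.2 : EReal)} + {p : G × ℝ | ‖p.1‖ ^ 2 / (2 * μ) < p.2})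
      (t := Set.range fun z : H => (L z, ⟪z, x⟫ - r))
      (hconv.add (convex_strict_epigraph_sq hμ)) (isOpen_strict_epigraph_sq μ).add_left
      (by
        rintro _ ⟨z₁, rfl⟩ _ ⟨z₂, rfl⟩ a b ha hb hab
        refine ⟨a • z₁ + b • z₂, ?_⟩
        ext
        · simp
        · simp only [inner_add_left, real_inner_smul_left, Prod.snd_add, Prod.smul_snd,
            smul_eq_mul]
          linear_combination r * hab)
      (by
        rw [Set.disjoint_left]
        rintro _ ⟨p, hp, q, hq, rfl⟩ ⟨z, hz⟩
        simp only [Set.mem_ofPred_eq] at hp hq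
        have h1 : L z = p.1 + q.1 := congrArg Prod.fst hz
        have h2 : ⟪z, x⟫ - r = p.2 + q.2 := congrArg Prod.snd hz
        have h3 := (hle z p.1).trans hp
        rw [h1, add_sub_cancel_left] at h3
        norm_cast at h3
        linarith)
    obtain ⟨α, hα⟩ : ∃ α : ℝ, α = f (0, 1) := ⟨_, rfl⟩
    obtain ⟨y', hy'⟩ : ∃ y' : G, ∀ v, ⟪v, y'⟫ = f (v, 0) := by
      refine ⟨(InnerProductSpace.toDual ℝ G).symm (f.comp (ContinuousLinearMap.inl ℝ G ℝ)),
        fun v => ?_⟩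
      rw [real_inner_comm, InnerProductSpace.toDual_symm_apply]
      simp
    have hf : ∀ v t, f (v, t) = ⟪v, y'⟫ + α * t := by
      intro v t
      rw [hy', hα, show (v, t) = (v, 0) + t • ((0, 1) : G × ℝ) by simp, map_add, map_smul,
        smul_eq_mul, mul_comm]
    have hA : ∀ w s u t, h w ≤ ((s : ℝ) : EReal) → ‖u‖ ^ 2 / (2 * μ) < t →
        ⟪w + u, y'⟫ + α * (s + t) < c := by
      intro w s u t hs ht
      rw [← hf]
      exact hfA _ ⟨(w, s), hs, (u, t), ht, rfl⟩
    have hB : ∀ z, c ≤ ⟪L z, y'⟫ + α * (⟪z, x⟫ - r) := by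
      intro z
      rw [← hf]
      exact hfB _ ⟨z, rfl⟩
    have hlin : ∀ z, ⟪L z, y'⟫ + α * ⟪z, x⟫ = 0 := by
      intro z
      by_contra hz
      have h1 := hB (((c + α * r - 1) / (⟪L z, y'⟫ + α * ⟪z, x⟫)) • z)
      rw [map_smul, real_inner_smul_left, real_inner_smul_left] at h1
      have h2 := div_mul_cancel₀ (c + α * r - 1) hz
      linarith
    have hc : c ≤ -α * r := by simpa using hB 0
    obtain ⟨⟨w₀, s₀⟩, hs₀⟩ := hne
    have hα0 : α < 0 := by
      by_contra! hα0
      have ht : ‖-w₀‖ ^ 2 / (2 * μ) < max (‖-w₀‖ ^ 2 / (2 * μ) + 1) (-r - s₀) :=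
        (lt_add_one _).trans_le (le_max_left _ _)
      have h1 := hA w₀ s₀ (-w₀) _ hs₀ ht
      rw [add_neg_cancel, inner_zero_left] at h1
      nlinarith [le_max_right (‖-w₀‖ ^ 2 / (2 * μ) + 1) (-r - s₀)]
    refine ⟨(-α)⁻¹ • y', ?_, fun w => EReal.le_of_forall_coe_ge fun s hs => ?_⟩
    · refine ext_inner_left ℝ fun z => ?_
      rw [ContinuousLinearMap.adjoint_inner_right, real_inner_smul_right,
        inv_mul_eq_iff_eq_mul₀ (neg_ne_zero.2 hα0.ne)]
      linarith [hlin z]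
    · set y := (-α)⁻¹ • y' with hy
      have hyy : y' = (-α) • y := by
        rw [hy, smul_smul, mul_inv_cancel₀ (neg_ne_zero.2 hα0.ne), one_smul]
      norm_cast
      refine le_of_forall_pos_le_add fun ε hε => ?_
      have hsq : ‖μ • y‖ ^ 2 / (2 * μ) = μ * qk y := by
        rw [norm_smul, mul_pow, Real.norm_eq_abs, sq_abs, qk]
        field_simp
      have h1 := hA w s (μ • y) (μ * qk y + ε) hs (by rw [hsq]; linarith)
      rw [hyy, real_inner_smul_right, inner_add_left, real_inner_smul_left,
        real_inner_self_eq_norm_sq] at h1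
      have h2 : (-α) * (⟪w, y⟫ + μ * ‖y‖ ^ 2 - (s + (μ * qk y + ε))) < (-α) * r := by linarith
      have h3 := lt_of_mul_lt_mul_left h2 (by linarith)
      unfold qk at h3 ⊢
      linarith
  · rintro ⟨y, rfl, hy⟩ z w
    refine le_trans (EReal.coe_le_coe_iff.2 ?_) (hy w)
    rw [ContinuousLinearMap.adjoint_inner_right]
    have h1 : 0 ≤ ‖(L z - w) - μ • y‖ ^ 2 / (2 * μ) := by positivity
    rw [norm_sub_sq_real, real_inner_smul_right, inner_sub_left, norm_smul, mul_pow,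
      Real.norm_eq_abs, sq_abs] at h1
    have h2 : (‖L z - w‖ ^ 2 - 2 * (μ * (⟪L z, y⟫ - ⟪w, y⟫)) + μ ^ 2 * ‖y‖ ^ 2) / (2 * μ) =
        ‖L z - w‖ ^ 2 / (2 * μ) - (⟪L z, y⟫ - ⟪w, y⟫) + μ * (‖y‖ ^ 2 / 2) := by
      field_simp
    unfold qk
    linarith

lemma proxComp_le_coe_iff {H G : Type*}
    [NormedAddCommGroup H] [InnerProductSpace ℝ H] [CompleteSpace H]
    [NormedAddCommGroup G] [InnerProductSpace ℝ G] [CompleteSpace G]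
    (L : H →L[ℝ] G) {γ : ℝ} (hγ : 0 < γ) (g : G → EReal)
    (hne : ∃ (u : G) (s : ℝ), fconj g u ≤ s) (x : H) (r : ℝ) :
    proxComp L γ g x ≤ r ↔ ∃ y, ContinuousLinearMap.adjoint L y = x ∧
      fconj (fconj g) y ≤ ((r - 1 / γ * (qk y - qk x) : ℝ) : EReal) := by
  obtain ⟨u, s, hus⟩ := hne
  have h1 : proxComp L γ g x ≤ r ↔ fconj (fun z => menv (1 / γ) (fconj g) (L z)) x ≤
      ((r + 1 / γ * qk x : ℝ) : EReal) := by
    unfold proxComp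
    induction fconj (fun z => menv (1 / γ) (fconj g) (L z)) x with
    | bot => simp
    | top => simp [-EReal.coe_add, -EReal.coe_mul]
    | coe t => norm_cast; constructor <;> intro h <;> linarith
  have h2 := forall_le_iff_exists_adjoint_eq L (one_div_pos.2 hγ) (fconj g)
    (convex_epigraph_fconj g) ⟨(u, s), hus⟩ x (r + 1 / γ * qk x)
  rw [h1, fconj_le_coe_iff]
  simp only [menv, le_iInf_iff, ← EReal.coe_sub_le_iff]
  rw [h2]
  simp only [fconj_le_coe_iff (fconj g)]
  have h3 : ∀ y : G, r + 1 / γ * qk x - 1 / γ * qk y = r - 1 / γ * (qk y - qk x) :=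
    fun y => by ring
  simp only [h3]

lemma proxCocomp_le_coe_iff {H G : Type*}
    [NormedAddCommGroup H] [InnerProductSpace ℝ H] [CompleteSpace H]
    [NormedAddCommGroup G] [InnerProductSpace ℝ G] [CompleteSpace G]
    (L : H →L[ℝ] G) {γ : ℝ} (hγ : 0 < γ) (g : G → EReal)
    (hne : ∃ (u : G) (s : ℝ), g u ≤ s) (x : H) (r : ℝ) :
    proxCocomp L γ g x ≤ r ↔ ∀ y, ((⟪y, L x⟫ - r -
      γ * (qk y - qk (ContinuousLinearMap.adjoint L y)) : ℝ) : EReal) ≤ fconj g y := by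
  obtain ⟨u, s, hus⟩ := hne
  have hne' : ∃ (u : G) (s : ℝ), fconj (fconj g) u ≤ s := ⟨u, s, (fconj_fconj_le g u).trans hus⟩
  rw [proxCocomp, fconj_le_coe_iff]
  have hcomp := proxComp_le_coe_iff L (one_div_pos.2 hγ) (fconj g) hne'
  simp only [fconj_fconj_fconj, one_div_one_div] at hcomp
  constructor
  · intro h y
    refine EReal.le_of_forall_coe_ge fun t ht => ?_
    have h1 := (h (ContinuousLinearMap.adjoint L y)).trans
      ((hcomp _ (t + γ * (qk y - qk (ContinuousLinearMap.adjoint L y)))).2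
        ⟨y, rfl, by simpa using ht⟩)
    rw [ContinuousLinearMap.adjoint_inner_left] at h1
    norm_cast at h1 ⊢
    linarith
  · intro h z
    refine EReal.le_of_forall_coe_ge fun t ht => ?_
    obtain ⟨y, rfl, hy⟩ := (hcomp _ _).1 ht
    have h1 := (h y).trans hy
    rw [ContinuousLinearMap.adjoint_inner_left]
    norm_cast at h1 ⊢
    linarith

lemma qk_adjoint_le {H G : Type*}
    [NormedAddCommGroup H] [InnerProductSpace ℝ H] [CompleteSpace H]
    [NormedAddCommGroup G] [InnerProductSpace ℝ G] [CompleteSpace G]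
    (L : H →L[ℝ] G) (y : G) : qk (ContinuousLinearMap.adjoint L y) ≤ ‖L‖ ^ 2 * qk y := by
  have h := (ContinuousLinearMap.adjoint L).le_opNorm y
  rw [LinearIsometryEquiv.norm_map] at h
  have h2 := pow_le_pow_left₀ (norm_nonneg _) h 2
  rw [mul_pow] at h2
  unfold qk
  linarith

/-- Asymptotics in the parameter: both `γ ↦ (L ⊙_γ g)(x)` and `γ ↦ (L ⊚_γ g)(x)` are
decreasing on `(0,∞)`; `(L ⊙_γ g)(x) → inf {g**(y) : L*y = x}` as `γ → +∞`;
`(L ⊚_γ g)(x) → g**(Lx)` as `γ → 0⁺`; and if `‖L‖ < 1` then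
`(L ⊚_γ g)(x) → inf g**` as `γ → +∞`. -/
theorem proxComp_proxCocomp_asymptotics
    {H G : Type*} [NormedAddCommGroup H] [InnerProductSpace ℝ H] [CompleteSpace H]
    [NormedAddCommGroup G] [InnerProductSpace ℝ G] [CompleteSpace G]
    (L : H →L[ℝ] G) (hL0 : 0 < ‖L‖) (hL1 : ‖L‖ ≤ 1)
    (g : G → EReal) (hg : ProperE g) (hm : HasAffMinorant g) (x : H) :
    AntitoneOn (fun γ : ℝ => proxComp L γ g x) (Set.Ioi (0 : ℝ)) ∧
    AntitoneOn (fun γ : ℝ => proxCocomp L γ g x) (Set.Ioi (0 : ℝ)) ∧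
    Filter.Tendsto (fun γ : ℝ => proxComp L γ g x) Filter.atTop
      (nhds (⨅ y : {y : G // ContinuousLinearMap.adjoint L y = x}, fconj (fconj g) (y : G))) ∧
    Filter.Tendsto (fun γ : ℝ => proxCocomp L γ g x) (nhdsWithin 0 (Set.Ioi (0 : ℝ)))
      (nhds (fconj (fconj g) (L x))) ∧
    (‖L‖ < 1 →
      Filter.Tendsto (fun γ : ℝ => proxCocomp L γ g x) Filter.atTop
        (nhds (⨅ y : G, fconj (fconj g) y))) := by
  have hcomp {γ : ℝ} (hγ : 0 < γ) := proxComp_le_coe_iff L hγ g (x := x) (hne := by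
    obtain ⟨u, c, hc⟩ := hm
    refine ⟨u, -c, (fconj_le_coe_iff _ _ _).2 fun y => ?_⟩
    simpa using hc y)
  have hcocomp {γ : ℝ} (hγ : 0 < γ) := proxCocomp_le_coe_iff L hγ g (x := x) (hne := by
    obtain ⟨u, hu⟩ := hg.1
    exact ⟨u, (g u).toReal, EReal.le_coe_toReal hu⟩)
  have hq0 : ∀ y : G, 0 ≤ qk y := fun y => by unfold qk; positivity
  have hq : ∀ y, 0 ≤ qk y - qk (ContinuousLinearMap.adjoint L y) := fun y => by
    have h1 : ‖L‖ ^ 2 ≤ 1 := pow_le_one₀ hL0.le hL1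
    nlinarith [qk_adjoint_le L y, hq0 y]
  refine ⟨?_, ?_, ?_, ?_, ?_⟩
  · intro a ha b hb hab
    refine EReal.le_of_forall_coe_ge fun r hr => ?_
    obtain ⟨y, rfl, hy⟩ := (hcomp ha r).1 hr
    refine (hcomp hb r).2 ⟨y, rfl, hy.trans (EReal.coe_le_coe_iff.2 ?_)⟩
    have := mul_le_mul_of_nonneg_right (one_div_le_one_div_of_le ha hab) (hq y)
    linarith
  · intro a ha b hb hab
    refine EReal.le_of_forall_coe_ge fun r hr => ?_
    refine (hcocomp hb r).2 fun y =>
      le_trans (EReal.coe_le_coe_iff.2 ?_) ((hcocomp ha r).1 hr y)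
    have := mul_le_mul_of_nonneg_right hab (hq y)
    linarith
  · rw [tendsto_order]
    refine ⟨fun a ha => ?_, fun a ha => ?_⟩
    · filter_upwards [eventually_gt_atTop 0] with γ hγ
      refine ha.trans_le (EReal.le_of_forall_coe_ge fun r hr => ?_)
      obtain ⟨y, hyx, hy⟩ := (hcomp hγ r).1 hr
      refine (iInf_le _ (⟨y, hyx⟩ : {y : G // ContinuousLinearMap.adjoint L y = x})).trans
        (hy.trans (EReal.coe_le_coe_iff.2 ?_))
      have := mul_nonneg (one_div_pos.2 hγ).le (hq y)
      rw [hyx] at this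
      linarith
    · obtain ⟨⟨y, hyx⟩, hy⟩ := iInf_lt_iff.1 ha
      obtain ⟨r₁, hr₁, hr₁a⟩ := EReal.lt_iff_exists_real_btwn.1 hy
      obtain ⟨r₂, hr₂, hr₂a⟩ := EReal.lt_iff_exists_real_btwn.1 hr₁a
      have hlim : Tendsto (fun γ : ℝ => r₂ - 1 / γ * (qk y - qk x)) atTop (nhds r₂) := by
        simpa using tendsto_const_nhds.sub
          ((tendsto_inv_atTop_zero (𝕜 := ℝ)).mul_const (qk y - qk x))
      filter_upwards [eventually_gt_atTop 0,
        hlim.eventually_const_lt (EReal.coe_lt_coe_iff.1 hr₂)] with γ hγ hγ'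
      exact ((hcomp hγ r₂).2
        ⟨y, hyx, hr₁.le.trans (EReal.coe_le_coe_iff.2 hγ'.le)⟩).trans_lt hr₂a
  · rw [tendsto_order]
    refine ⟨fun a ha => ?_, fun a ha => ?_⟩
    · obtain ⟨r, har, hr⟩ := EReal.lt_iff_exists_real_btwn.1 ha
      have h1 := mt (fconj_le_coe_iff _ _ _).2 hr.not_ge
      push Not at h1
      obtain ⟨y, hy⟩ := h1
      obtain ⟨s, hs, hsr⟩ := EReal.lt_iff_exists_real_btwn.1 hy
      have hlim : Tendsto (fun γ : ℝ => ⟪y, L x⟫ - r -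
          γ * (qk y - qk (ContinuousLinearMap.adjoint L y))) (nhdsWithin 0 (Set.Ioi 0))
          (nhds (⟪y, L x⟫ - r)) := by
        refine Tendsto.mono_left ?_ nhdsWithin_le_nhds
        refine Continuous.tendsto' (by fun_prop) _ _ (by simp)
      filter_upwards [self_mem_nhdsWithin,
        hlim.eventually_const_lt (EReal.coe_lt_coe_iff.1 hsr)] with γ hγ hγ'
      refine har.trans (lt_of_not_ge fun hle => ?_)
      have h2 := ((hcocomp hγ r).1 hle y).trans_lt hs
      exact (EReal.coe_lt_coe_iff.1 h2).not_gt hγ'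
    · filter_upwards [self_mem_nhdsWithin] with γ hγ
      refine lt_of_le_of_lt (EReal.le_of_forall_coe_ge fun r hr => ?_) ha
      refine (hcocomp hγ r).2 fun y =>
        le_trans (EReal.coe_le_coe_iff.2 ?_) ((fconj_le_coe_iff _ _ _).1 hr y)
      have := mul_nonneg (le_of_lt hγ) (hq y)
      linarith
  · intro hL
    rw [tendsto_order]
    refine ⟨fun a ha => ?_, fun a ha => ?_⟩
    · filter_upwards [eventually_gt_atTop 0] with γ hγ
      refine ha.trans_le (EReal.le_of_forall_coe_ge fun r hr => le_of_not_gt fun hlt => ?_)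
      obtain ⟨s, hrs, hs⟩ := EReal.lt_iff_exists_real_btwn.1 hlt
      have h1 : fconj g 0 ≤ ((-s : ℝ) : EReal) := by
        rw [← fconj_fconj_fconj g, fconj_le_coe_iff]
        intro y
        simpa using hs.le.trans (iInf_le _ y)
      have h2 := ((hcocomp hγ r).1 hr 0).trans h1
      have h3 := EReal.coe_lt_coe_iff.1 hrs
      simp only [qk, inner_zero_left, map_zero, norm_zero] at h2
      norm_num at h2
      linarith
    · obtain ⟨v, hv⟩ := iInf_lt_iff.1 ha
      obtain ⟨r₁, hr₁, hr₁a⟩ := EReal.lt_iff_exists_real_btwn.1 hv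
      obtain ⟨r₂, hr₂, hr₂a⟩ := EReal.lt_iff_exists_real_btwn.1 hr₁a
      have hr₁₂ := EReal.coe_lt_coe_iff.1 hr₂
      have hc : 0 < 1 - ‖L‖ ^ 2 := by nlinarith
      filter_upwards [eventually_gt_atTop 0,
        eventually_ge_atTop (‖L x - v‖ ^ 2 / (2 * (1 - ‖L‖ ^ 2) * (r₂ - r₁)))] with γ hγ hγ'
      refine lt_of_le_of_lt ((hcocomp hγ r₂).2 fun y => ?_) hr₂a
      refine le_trans (EReal.coe_le_coe_iff.2 ?_) ((fconj_le_coe_iff _ _ _).1 hr₁.le y)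
      rw [div_le_iff₀ (by have := sub_pos.2 hr₁₂; positivity)] at hγ'
      have h1 : (1 - ‖L‖ ^ 2) * qk y ≤ qk y - qk (ContinuousLinearMap.adjoint L y) := by
        linarith [qk_adjoint_le L y]
      have h2 := mul_le_mul_of_nonneg_left h1 hγ.le
      have h3 : ⟪y, L x⟫ - ⟪y, v⟫ ≤ ‖y‖ * ‖L x - v‖ := by
        rw [← inner_sub_right]
        exact real_inner_le_norm _ _
      have hk : 0 < γ * (1 - ‖L‖ ^ 2) := mul_pos hγ hc
      have h4 : ‖y‖ * ‖L x - v‖ ≤ γ * ((1 - ‖L‖ ^ 2) * qk y) + (r₂ - r₁) := by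
        unfold qk
        refine le_of_mul_le_mul_left ?_ hk
        nlinarith [sq_nonneg (γ * (1 - ‖L‖ ^ 2) * ‖y‖ - ‖L x - v‖)]
      linarith
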